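/- arXiv:2205.14973 — 2 statements merged into one kernel-verified Lean document; each statement's English description precedes it below -/
import Mathlib

section
/- Let c ∈ ℝ and let ĝ be the constant metric on ℝ⁴ (coordinates (u,v,x,y)) with components ĝ_{uu} = −c, ĝ_{uv} = ĝ_{vu} = 1, ĝ_{xx} = ĝ_{yy} = 1, and all others zero. Then each of the following vector fields is a Killing vector of ĝ, i.e. satisfies (L_Υ ĝ)_{μν} = 0 everywhere: Υ₀ with components (Υ₀^u, Υ₀^v, Υ₀^x, Υ₀^y) = (u, cu − v, 0, 0); Υ_{vx} with components (−x, −cx, v, 0); and Υ_{vy} with components (−y, −cy, 0, v). -/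
/-- Partial derivative of a scalar function on ℝ^N in the i-th coordinate direction. -/
noncomputable def pd {N : ℕ} (f : (Fin N → ℝ) → ℝ) (i : Fin N) (x : Fin N → ℝ) : ℝ :=
  fderiv ℝ f x (Pi.single i 1)

/-- Lie derivative of a covariant 2-tensor field `T` along the vector field `V`. -/
noncomputable def lieD {N : ℕ} (V : (Fin N → ℝ) → Fin N → ℝ)
    (T : (Fin N → ℝ) → Fin N → Fin N → ℝ) (x : Fin N → ℝ) (μ ν : Fin N) : ℝ :=
  ∑ σ, (V x σ * pd (fun y => T y μ ν) σ x
    + T x σ ν * pd (fun y => V y σ) μ x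
    + T x μ σ * pd (fun y => V y σ) ν x)

/-- The constant disformal metric ĝ on ℝ⁴ (coordinates (u,v,x,y) = indices (0,1,2,3)):
ĝ_{uu} = −c, ĝ_{uv} = ĝ_{vu} = 1, ĝ_{xx} = ĝ_{yy} = 1, all other components zero. -/
noncomputable def hatMetric (c : ℝ) (x : Fin 4 → ℝ) (μ ν : Fin 4) : ℝ :=
  if μ = 0 ∧ ν = 0 then -c
  else if (μ = 0 ∧ ν = 1) ∨ (μ = 1 ∧ ν = 0) then 1
  else if (μ = 2 ∧ ν = 2) ∨ (μ = 3 ∧ ν = 3) then 1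
  else 0

theorem pd_const {N : ℕ} (a : ℝ) (i : Fin N) (x : Fin N → ℝ) :
    pd (fun _ => a) i x = 0 := by
  simp [pd]

theorem pd_mulVec {N : ℕ} (A : Matrix (Fin N) (Fin N) ℝ) (σ i : Fin N) (x : Fin N → ℝ) :
    pd (fun y => A.mulVec y σ) i x = A σ i := by
  have h : HasFDerivAt (fun y : Fin N → ℝ => A.mulVec y σ)
      (∑ j, A σ j • ContinuousLinearMap.proj (R := ℝ) (φ := fun _ : Fin N => ℝ) j) x := by
    simp only [Matrix.mulVec, dotProduct]
    exact HasFDerivAt.fun_sum fun j _ => (hasFDerivAt_apply j x).const_mul (A σ j)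
  simp [pd, h.fderiv, Pi.single_apply]

/-- The Lie derivative of a constant tensor along the linear vector field `x ↦ A x`
is `Aᵀ T + T A`. -/
theorem lieD_mulVec {N : ℕ} (A T : Matrix (Fin N) (Fin N) ℝ) (x : Fin N → ℝ) (μ ν : Fin N) :
    lieD A.mulVec (fun _ => T) x μ ν = (A.transpose * T + T * A) μ ν := by
  simp [lieD, pd_const, pd_mulVec, Matrix.mul_apply, Finset.sum_add_distrib, mul_comm]

theorem lieD_hatMetric_eq_zero {c : ℝ} {V : (Fin 4 → ℝ) → Fin 4 → ℝ}
    (A : Matrix (Fin 4) (Fin 4) ℝ) (hV : V = A.mulVec)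
    (hA : ∀ μ ν, (A.transpose * Matrix.of (hatMetric c 0) +
      Matrix.of (hatMetric c 0) * A) μ ν = 0)
    (x : Fin 4 → ℝ) (μ ν : Fin 4) : lieD V (hatMetric c) x μ ν = 0 := by
  rw [hV]
  exact (lieD_mulVec A (Matrix.of (hatMetric c 0)) x μ ν).trans (hA μ ν)

theorem stmt18 (c : ℝ)
    (Υ₀ Υvx Υvy : (Fin 4 → ℝ) → Fin 4 → ℝ)
    (hΥ₀ : Υ₀ = fun x μ =>
      if μ = 0 then x 0 else if μ = 1 then c * x 0 - x 1 else 0)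
    (hΥvx : Υvx = fun x μ =>
      if μ = 0 then -x 2 else if μ = 1 then -c * x 2 else if μ = 2 then x 1 else 0)
    (hΥvy : Υvy = fun x μ =>
      if μ = 0 then -x 3 else if μ = 1 then -c * x 3 else if μ = 3 then x 1 else 0) :
    (∀ x : Fin 4 → ℝ, ∀ μ ν : Fin 4, lieD Υ₀ (hatMetric c) x μ ν = 0)
    ∧ (∀ x : Fin 4 → ℝ, ∀ μ ν : Fin 4, lieD Υvx (hatMetric c) x μ ν = 0)
    ∧ (∀ x : Fin 4 → ℝ, ∀ μ ν : Fin 4, lieD Υvy (hatMetric c) x μ ν = 0) := by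
  refine ⟨lieD_hatMetric_eq_zero !![1, 0, 0, 0; c, -1, 0, 0; 0, 0, 0, 0; 0, 0, 0, 0] ?_ ?_,
    lieD_hatMetric_eq_zero !![0, 0, -1, 0; 0, 0, -c, 0; 0, 1, 0, 0; 0, 0, 0, 0] ?_ ?_,
    lieD_hatMetric_eq_zero !![0, 0, 0, -1; 0, 0, 0, -c; 0, 0, 0, 0; 0, 1, 0, 0] ?_ ?_⟩
  · rw [hΥ₀]
    ext x μ
    fin_cases μ <;> simp [Matrix.mulVec, dotProduct, Fin.sum_univ_four, sub_eq_add_neg]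
  · intro μ ν
    fin_cases μ <;> fin_cases ν <;>
      simp [Matrix.mul_apply, Fin.sum_univ_four, hatMetric]
  · rw [hΥvx]
    ext x μ
    fin_cases μ <;> simp [Matrix.mulVec, dotProduct, Fin.sum_univ_four]
  · intro μ ν
    fin_cases μ <;> fin_cases ν <;>
      simp [Matrix.mul_apply, Fin.sum_univ_four, hatMetric]
  · rw [hΥvy]
    ext x μ
    fin_cases μ <;> simp [Matrix.mulVec, dotProduct, Fin.sum_univ_four]
  · intro μ ν
    fin_cases μ <;> fin_cases ν <;>
      simp [Matrix.mul_apply, Fin.sum_univ_four, hatMetric]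
end

section
/- Let b ∈ (0,1), m > 0 and let p₀, p_x, p_y, p_z, t₀, x₀, y₀, z₀ be real constants with Q := p₀ + p_z > 0, satisfying the constraint p₀² − p_x² − p_y² − p_z² = 2^{−b/(1+b)}·(1+b)·(1−b)^{(1−b)/(1+b)}·m^{2/(1+b)}·Q^{2b/(1+b)}. Set A = (p_x² + p_y²)/Q², B = 2^{−b/(1+b)}·(1−b)^{2/(1+b)}·m^{2/(1+b)}·Q^{−2/(1+b)}, and define the curve n(λ) = 2^{−b/(1+b)}·(1−b)^{(1−b)/(1+b)}·m^{−2b/(1+b)}·Q^{2b/(1+b)} (constant), t(λ) = t₀ − (1/2)(A + 1 + B)Qλ, x(λ) = x₀ + p_x λ, y(λ) = y₀ + p_y λ, z(λ) = z₀ − (1/2)(A − 1 + B)Qλ. Consider the flat Bogoslovsky Lagrangian L = −(1/(2^{1+b} n))·(ż − ṫ)^{2b}·(ṫ² − ẋ² − ẏ² − ż²)^{1−b} − n m²/2. Then along this curve: ż − ṫ = Q > 0 and ṫ² − ẋ² − ẏ² − ż² = BQ² > 0; the einbein constraint ∂L/∂n = 0 holds; and the momenta take the values ∂L/∂ṫ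 = p₀, ∂L/∂ẋ = p_x, ∂L/∂ẏ = p_y, ∂L/∂ż = p_z (in particular all four momenta are constant, so the curve solves the Euler–Lagrange equations of L). -/
/-- The flat Bogoslovsky einbein Lagrangian in Cartesian coordinates,
L(n,ṫ,ẋ,ẏ,ż) = −(1/(2^{1+b} n))·(ż−ṫ)^{2b}·(ṫ²−ẋ²−ẏ²−ż²)^{1−b} − n m²/2. -/
noncomputable def bogoCartL (b m : ℝ) (n dt dx dy dz : ℝ) : ℝ :=
  -(1 / ((2 : ℝ) ^ (1 + b) * n)) * (dz - dt) ^ (2 * b)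
    * (dt ^ 2 - dx ^ 2 - dy ^ 2 - dz ^ 2) ^ (1 - b) - n * m ^ 2 / 2

/-- The derivative of `-(1 / (2 ^ (1 + b) * N)) * u ^ (2 * b) * S ^ (1 - b) - k` along a curve, on the
shell where the einbein equation and `S = (1 - b) * N * m ^ 2` hold. -/
theorem hasDerivAt_bogo_onShell {b m N k : ℝ} (hN : 0 < N) {u S : ℝ → ℝ} {u' S' w : ℝ}
    (hu : HasDerivAt u u' w) (hS : HasDerivAt S S' w) (hu0 : 0 < u w) (hS0 : 0 < S w)
    (hSN : S w = (1 - b) * N * m ^ 2)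
    (hP : u w ^ (2 * b) * S w ^ (1 - b) = 2 ^ b * N ^ 2 * m ^ 2) :
    HasDerivAt (fun v => -(1 / ((2 : ℝ) ^ (1 + b) * N)) * u v ^ (2 * b) * S v ^ (1 - b) - k)
      (-(b * N * m ^ 2 * u' / u w) - S' / 2) w := by
  have h := (((hu.rpow_const (p := 2 * b) (Or.inl hu0.ne')).const_mul
    (-(1 / ((2 : ℝ) ^ (1 + b) * N)))).mul
      (hS.rpow_const (p := 1 - b) (Or.inl hS0.ne'))).sub_const k
  refine h.congr_deriv ?_
  have h2 : (2 : ℝ) ^ (1 + b) = 2 * 2 ^ b := by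
    rw [Real.rpow_add two_pos, Real.rpow_one]
  have h2b : (0 : ℝ) < 2 ^ b := Real.rpow_pos_of_pos two_pos b
  rw [Real.rpow_sub_one hu0.ne', Real.rpow_sub_one hS0.ne', h2]
  calc _ = -(1 / (2 * 2 ^ b * N)) * (u w ^ (2 * b) * S w ^ (1 - b))
        * (2 * b * u' / u w + (1 - b) * S' / S w) := by ring
    _ = -(b * N * m ^ 2 * u' / u w) - ((1 - b) * N * m ^ 2) * S' / (2 * S w) := by
        rw [hP]
        field_simp
        ring
    _ = _ := by
        rw [← hSN]
        field_simp

/-- The einbein equation `∂L/∂n = 0`. -/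
theorem hasDerivAt_bogo_einbein {b m N P : ℝ} (hN : 0 < N)
    (hP : P = 2 ^ b * N ^ 2 * m ^ 2) :
    HasDerivAt (fun v => -(1 / ((2 : ℝ) ^ (1 + b) * v)) * P - v * m ^ 2 / 2) 0 N := by
  have h2 : (2 : ℝ) ^ (1 + b) = 2 * 2 ^ b := by
    rw [Real.rpow_add two_pos, Real.rpow_one]
  have h2b : (0 : ℝ) < 2 ^ b := Real.rpow_pos_of_pos two_pos b
  have h := (((hasDerivAt_inv hN.ne').const_mul (-(P / (2 * 2 ^ b)))).sub
    (((hasDerivAt_id N).mul_const (m ^ 2)).div_const 2))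
  refine (h.congr_deriv ?_).congr_of_eventuallyEq (.of_forall fun v => ?_)
  · rw [hP]
    field_simp
    ring
  · simp only [h2, Pi.sub_apply, id]
    rw [one_div, mul_inv (2 * 2 ^ b) v]
    ring

theorem stmt19 (b m : ℝ) (hb0 : 0 < b) (hb1 : b < 1) (hm : 0 < m)
    (p₀ px py pz t₀ x₀ y₀ z₀ : ℝ)
    (Q : ℝ) (hQ : Q = p₀ + pz) (hQpos : 0 < Q)
    (hconstraint : p₀ ^ 2 - px ^ 2 - py ^ 2 - pz ^ 2
      = (2 : ℝ) ^ (-b / (1 + b)) * (1 + b) * (1 - b) ^ ((1 - b) / (1 + b))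
        * m ^ (2 / (1 + b)) * Q ^ (2 * b / (1 + b)))
    (A B : ℝ)
    (hA : A = (px ^ 2 + py ^ 2) / Q ^ 2)
    (hB : B = (2 : ℝ) ^ (-b / (1 + b)) * (1 - b) ^ (2 / (1 + b))
      * m ^ (2 / (1 + b)) * Q ^ (-2 / (1 + b)))
    (n t x y z : ℝ → ℝ)
    (hn : n = fun _ => (2 : ℝ) ^ (-b / (1 + b)) * (1 - b) ^ ((1 - b) / (1 + b))
      * m ^ (-(2 * b) / (1 + b)) * Q ^ (2 * b / (1 + b)))
    (ht : t = fun lam => t₀ - (1 / 2) * (A + 1 + B) * Q * lam)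
    (hx : x = fun lam => x₀ + px * lam)
    (hy : y = fun lam => y₀ + py * lam)
    (hz : z = fun lam => z₀ - (1 / 2) * (A - 1 + B) * Q * lam) :
    ∀ lam : ℝ,
      -- ż − ṫ = Q > 0
      (deriv z lam - deriv t lam = Q)
      -- ṫ² − ẋ² − ẏ² − ż² = BQ² > 0
      ∧ ((deriv t lam) ^ 2 - (deriv x lam) ^ 2 - (deriv y lam) ^ 2 - (deriv z lam) ^ 2
          = B * Q ^ 2)
      ∧ (0 < B * Q ^ 2)
      -- the einbein constraint ∂L/∂n = 0
      ∧ (deriv (fun w => bogoCartL b m w (deriv t lam) (deriv x lam) (deriv y lam)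
          (deriv z lam)) (n lam) = 0)
      -- the values of the four momenta
      ∧ (deriv (fun w => bogoCartL b m (n lam) w (deriv x lam) (deriv y lam)
          (deriv z lam)) (deriv t lam) = p₀)
      ∧ (deriv (fun w => bogoCartL b m (n lam) (deriv t lam) w (deriv y lam)
          (deriv z lam)) (deriv x lam) = px)
      ∧ (deriv (fun w => bogoCartL b m (n lam) (deriv t lam) (deriv x lam) w
          (deriv z lam)) (deriv y lam) = py)
      ∧ (deriv (fun w => bogoCartL b m (n lam) (deriv t lam) (deriv x lam) (deriv y lam) w)
          (deriv z lam) = pz) := by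
  intro lam
  have h1b : 0 < 1 - b := sub_pos.2 hb1
  have dt : deriv t lam = -(1 / 2) * (A + 1 + B) * Q := by
    have h := ((hasDerivAt_id lam).const_mul ((1 / 2) * (A + 1 + B) * Q)).const_sub t₀
    rw [ht]
    exact (h.congr_deriv (by ring)).deriv
  have dz : deriv z lam = -(1 / 2) * (A - 1 + B) * Q := by
    have h := ((hasDerivAt_id lam).const_mul ((1 / 2) * (A - 1 + B) * Q)).const_sub z₀
    rw [hz]
    exact (h.congr_deriv (by ring)).deriv
  have dx : deriv x lam = px := by
    have h := ((hasDerivAt_id lam).const_mul px).const_add x₀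
    rw [hx]
    exact (h.congr_deriv (by ring)).deriv
  have dy : deriv y lam = py := by
    have h := ((hasDerivAt_id lam).const_mul py).const_add y₀
    rw [hy]
    exact (h.congr_deriv (by ring)).deriv
  rw [dt, dx, dy, dz]
  obtain ⟨N, hNdef⟩ : ∃ N, N = n lam := ⟨_, rfl⟩
  rw [← hNdef]
  rw [hn] at hNdef
  have exp_two_log : ∀ {a : ℝ}, 0 < a → a ^ 2 = Real.exp (Real.log a * 2) := fun {a} ha => by
    rw [← Real.rpow_def_of_pos ha, Real.rpow_two]
  have hN : 0 < N := by rw [hNdef]; positivity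
  have hNm : N * m ^ 2 = (2 : ℝ) ^ (-b / (1 + b)) * (1 - b) ^ ((1 - b) / (1 + b))
      * m ^ (2 / (1 + b)) * Q ^ (2 * b / (1 + b)) := by
    rw [hNdef]
    simp only [Real.rpow_def_of_pos two_pos, Real.rpow_def_of_pos h1b, Real.rpow_def_of_pos hm,
      Real.rpow_def_of_pos hQpos, exp_two_log hm, ← Real.exp_add]
    congr 1
    field_simp
    ring
  have hBQ' : B * Q ^ 2 = (2 : ℝ) ^ (-b / (1 + b)) * (1 - b) ^ (2 / (1 + b))
      * m ^ (2 / (1 + b)) * Q ^ (2 * b / (1 + b)) := by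
    rw [hB]
    simp only [Real.rpow_def_of_pos two_pos, Real.rpow_def_of_pos h1b, Real.rpow_def_of_pos hm,
      Real.rpow_def_of_pos hQpos, exp_two_log hQpos, ← Real.exp_add]
    congr 1
    field_simp
    ring
  have hBQ : B * Q ^ 2 = (1 - b) * N * m ^ 2 := by
    rw [mul_assoc, hNm, hBQ']
    have : (1 - b) ^ (2 / (1 + b)) = (1 - b) * (1 - b) ^ ((1 - b) / (1 + b)) := by
      rw [← Real.rpow_one_add' h1b.le (by positivity)]
      congr 1
      field_simp
      ring
    rw [this]
    ring
  have hBQpos : 0 < B * Q ^ 2 := by rw [hBQ]; positivity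
  have hP : Q ^ (2 * b) * (B * Q ^ 2) ^ (1 - b) = 2 ^ b * N ^ 2 * m ^ 2 := by
    rw [hBQ', hNdef]
    simp only [Real.rpow_def_of_pos two_pos, Real.rpow_def_of_pos h1b, Real.rpow_def_of_pos hm,
      Real.rpow_def_of_pos hQpos, exp_two_log hm, ← Real.exp_add, Real.rpow_def_of_pos
      (Real.exp_pos _), Real.log_exp, ← Real.exp_nat_mul]
    congr 1
    push_cast
    field_simp
    ring
  have hAQ : A * Q ^ 2 = px ^ 2 + py ^ 2 := by
    rw [hA]
    field_simp
  have hc : p₀ ^ 2 - px ^ 2 - py ^ 2 - pz ^ 2 = (1 + b) * N * m ^ 2 := by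
    rw [hconstraint, mul_assoc (1 + b), hNm]
    ring
  have hU : -(1 / 2) * (A - 1 + B) * Q - -(1 / 2) * (A + 1 + B) * Q = Q := by ring
  have hS : (-(1 / 2) * (A + 1 + B) * Q) ^ 2 - px ^ 2 - py ^ 2 - (-(1 / 2) * (A - 1 + B) * Q) ^ 2
      = B * Q ^ 2 := by
    linear_combination hAQ
  obtain ⟨T, hT⟩ : ∃ T, T = -(1 / 2) * (A + 1 + B) * Q := ⟨_, rfl⟩
  obtain ⟨Z, hZ⟩ : ∃ Z, Z = -(1 / 2) * (A - 1 + B) * Q := ⟨_, rfl⟩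
  rw [← hT, ← hZ] at hU hS ⊢
  have hU0 : 0 < Z - T := by rwa [hU]
  have hS0 : 0 < T ^ 2 - px ^ 2 - py ^ 2 - Z ^ 2 := by rwa [hS]
  have hSN := hS.trans hBQ
  have hP' : (Z - T) ^ (2 * b) * (T ^ 2 - px ^ 2 - py ^ 2 - Z ^ 2) ^ (1 - b)
      = 2 ^ b * N ^ 2 * m ^ 2 := by rw [hU, hS, hP]
  have hsq := fun w : ℝ => hasDerivAt_pow 2 w
  refine ⟨hU, hS, hBQpos, ?_, ?_, ?_, ?_, ?_⟩
  · simp only [bogoCartL, mul_assoc _ ((Z - T) ^ (2 * b))]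
    exact (hasDerivAt_bogo_einbein hN hP').deriv
  · have h := hasDerivAt_bogo_onShell (k := N * m ^ 2 / 2) hN ((hasDerivAt_id T).const_sub Z)
      ((((hsq T).sub_const (px ^ 2)).sub_const (py ^ 2)).sub_const (Z ^ 2)) hU0 hS0 hSN hP'
    refine h.deriv.trans ?_
    simp only [id, hU]
    rw [hT]
    field_simp
    push_cast
    subst hQ
    linear_combination hAQ + hBQ - hc
  · have h := hasDerivAt_bogo_onShell (k := N * m ^ 2 / 2) hN (hasDerivAt_const px (Z - T))
      ((((hsq px).const_sub (T ^ 2)).sub_const (py ^ 2)).sub_const (Z ^ 2)) hU0 hS0 hSN hP'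
    refine h.deriv.trans ?_
    push_cast
    ring
  · have h := hasDerivAt_bogo_onShell (k := N * m ^ 2 / 2) hN (hasDerivAt_const py (Z - T))
      (((hsq py).const_sub (T ^ 2 - px ^ 2)).sub_const (Z ^ 2)) hU0 hS0 hSN hP'
    refine h.deriv.trans ?_
    push_cast
    ring
  · have h := hasDerivAt_bogo_onShell (k := N * m ^ 2 / 2) hN ((hasDerivAt_id Z).sub_const T)
      ((hsq Z).const_sub (T ^ 2 - px ^ 2 - py ^ 2)) hU0 hS0 hSN hP'
    refine h.deriv.trans ?_
    simp only [id, hU]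
    rw [hZ]
    field_simp
    push_cast
    subst hQ
    linear_combination hc - hAQ - hBQ
end
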